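/- Let 0 ≤ j < n be integers and K ∈ ℕ, and let f : [t_j, t_{j+1}] → ℝ be (K+1) times continuously differentiable. Suppose T_{n,j}[p] = 0 for every polynomial p of degree at most K, and suppose the Peano kernel ξ ↦ T_{n,j}[G_{ξ,K}] does not change sign on [t_j, t_{j+1}] (it is either nonnegative for all ξ ∈ [t_j, t_{j+1}] or nonpositive for all ξ ∈ [t_j, t_{j+1}]). Then there exists ζ ∈ (t_j, t_{j+1}) such that T_{n,j}[f] = (f^{(K+1)}(ζ)/(K+1)!) · T_{n,j}[G_{t_j,K+1}]. -/

import Mathlib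

open MeasureTheory Real

/-- Generalized Mittag–Leffler function `e_{α,β}(t; z)`. -/
noncomputable def mlE (α β t z : ℝ) : ℝ :=
  ∑' k : ℕ, (-z) ^ k * t ^ (α * (k : ℝ) + β - 1) / Real.Gamma (α * (k : ℝ) + β)

/-- The generalized step function `G_{ξ,k}(t) = (t-ξ)_+^k`. -/
noncomputable def stepG (ξ : ℝ) (k : ℕ) (t : ℝ) : ℝ :=
  if ξ ≤ t then (t - ξ) ^ k else 0

/-- The quadrature remainder `T_{n,j}[g] = I_j[g,t_n] - Q_{n,j}[g]` for the mesh
`t_j = t_0 + j h`, nodes `c` and weights `b`. -/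
noncomputable def quadT (α lam t0 h : ℝ) {ν : ℕ} (c : Fin ν → ℝ) (b : Fin ν → ℕ → ℝ)
    (n j : ℕ) (g : ℝ → ℝ) : ℝ :=
  (∫ s in (t0 + (j : ℝ) * h)..(t0 + ((j : ℝ) + 1) * h),
      mlE α α (t0 + (n : ℝ) * h - s) lam * g s)
    - ∑ r, b r (n - j) * g (t0 + (j : ℝ) * h + c r * h)

open Set

theorem Real.rpow_mul_le_Gamma {M x : ℝ} (hM : 0 < M) (hx : 0 < x) :
    exp (-(M + 1)) / (M + 1) * M ^ x ≤ Gamma x := by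
  have hint := GammaIntegral_convergent hx
  have hsub : Ioc M (M + 1) ⊆ Ioi (0 : ℝ) := fun t ht => hM.trans ht.1
  rw [Gamma_eq_integral hx]
  calc exp (-(M + 1)) / (M + 1) * M ^ x
      = ∫ _ in Ioc M (M + 1), exp (-(M + 1)) / (M + 1) * M ^ x := by simp
    _ ≤ ∫ t in Ioc M (M + 1), exp (-t) * t ^ (x - 1) := by
      refine setIntegral_mono_on (integrableOn_const (by simp)) (hint.mono_set hsub) measurableSet_Ioc ?_
      intro t ht
      have ht0 : 0 < t := hM.trans ht.1
      rw [rpow_sub_one ht0.ne', div_mul_eq_mul_div, mul_div_assoc]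
      gcongr
      · exact ht.2
      · exact ht.1.le
      · exact ht.2
    _ ≤ ∫ t in Ioi 0, exp (-t) * t ^ (x - 1) := by
      refine setIntegral_mono_set hint ?_ hsub.eventuallyLE
      filter_upwards [ae_restrict_mem measurableSet_Ioi] with t ht
      exact mul_nonneg (exp_pos _).le (rpow_nonneg (le_of_lt ht) _)

theorem summable_pow_div_Gamma {α : ℝ} (hα : 0 < α) {R : ℝ} (hR : 0 ≤ R) :
    Summable fun k : ℕ => R ^ k / Gamma (α * k + α) := by
  set M : ℝ := (2 * (R + 1)) ^ α⁻¹
  have hM : 0 < M := by positivity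
  have hMα : M ^ α = 2 * (R + 1) := rpow_inv_rpow (by positivity) hα.ne'
  set C : ℝ := exp (-(M + 1)) / (M + 1) * M ^ α
  have hC : 0 < C := by positivity
  refine Summable.of_nonneg_of_le (fun k => ?_) (fun k => ?_)
    ((summable_geometric_of_lt_one (by norm_num) (by norm_num : (1 / 2 : ℝ) < 1)).mul_left C⁻¹)
  · exact div_nonneg (by positivity) (Gamma_pos_of_pos (by positivity)).le
  · have hlow := rpow_mul_le_Gamma hM (x := α * k + α) (by positivity)
    rw [rpow_add hM, rpow_mul hM.le, rpow_natCast, hMα] at hlow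
    rw [div_le_iff₀ (Gamma_pos_of_pos (by positivity))]
    calc R ^ k ≤ (R + 1) ^ k := by gcongr; linarith
      _ = C⁻¹ * (1 / 2) ^ k * (C * (2 * (R + 1)) ^ k) := by
        rw [mul_pow 2, div_pow, one_pow]; field_simp
      _ ≤ _ := by
        gcongr
        simp only [C, hMα]
        linarith

theorem continuous_tsum_neg_pow_div_Gamma {α : ℝ} (hα : 0 < α) (z : ℝ) :
    Continuous fun x : ℝ => ∑' k : ℕ, (-z) ^ k * x ^ k / Gamma (α * k + α) := by
  refine continuous_iff_continuousAt.2 fun x₀ => ?_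
  have hnhds : Metric.ball (0 : ℝ) (|x₀| + 1) ∈ nhds x₀ :=
    Metric.isOpen_ball.mem_nhds (by simp)
  refine ContinuousOn.continuousAt (continuousOn_tsum (fun k => by fun_prop)
    (summable_pow_div_Gamma hα (R := |z| * (|x₀| + 1)) (by positivity)) fun k x hx => ?_) hnhds
  have hx' : |x| ≤ |x₀| + 1 := by simpa using (mem_ball_zero_iff.1 hx).le
  have hΓ : 0 < Gamma (α * k + α) := Gamma_pos_of_pos (by positivity)
  rw [norm_div, ← mul_pow, norm_pow, norm_mul, norm_neg, norm_of_nonneg hΓ.le]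
  simp only [Real.norm_eq_abs]
  gcongr

theorem mlE_eq_rpow_mul_tsum {α t : ℝ} (ht : 0 < t) (z : ℝ) :
    mlE α α t z = t ^ (α - 1) * ∑' k : ℕ, (-z) ^ k * (t ^ α) ^ k / Gamma (α * k + α) := by
  rw [mlE, ← tsum_mul_left]
  congr 1 with k
  rw [add_sub_assoc, rpow_add ht, rpow_mul ht.le, rpow_natCast]
  ring

theorem intervalIntegrable_mlE {α : ℝ} (hα : 0 < α) (z : ℝ) {a b : ℝ} (ha : 0 ≤ a) (hb : 0 ≤ b) :
    IntervalIntegrable (fun t => mlE α α t z) volume a b := by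
  have hcont : Continuous fun t : ℝ =>
      ∑' k : ℕ, (-z) ^ k * (t ^ α) ^ k / Gamma (α * k + α) :=
    (continuous_tsum_neg_pow_div_Gamma hα z).comp (continuous_id.rpow_const fun _ => .inr hα.le)
  refine ((intervalIntegral.intervalIntegrable_rpow' (r := α - 1) (by linarith)).mul_continuousOn
    hcont.continuousOn).congr fun t ht => ?_
  exact (mlE_eq_rpow_mul_tsum ((le_min ha hb).trans_lt ht.1) z).symm

/-- A weighted integral minus a quadrature sum. -/
noncomputable def quadratureError {ι : Type*} [Fintype ι] (w : ℝ → ℝ) (a b : ℝ) (β x : ι → ℝ)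
    (g : ℝ → ℝ) : ℝ :=
  (∫ s in a..b, w s * g s) - ∑ r, β r * g (x r)

section PeanoKernel

variable {ι : Type*} [Fintype ι] {w : ℝ → ℝ} {a b : ℝ} {β x : ι → ℝ}

theorem quadratureError_congr (hab : a ≤ b) (hx : ∀ r, x r ∈ Icc a b) {f g : ℝ → ℝ}
    (hfg : EqOn f g (Icc a b)) :
    quadratureError w a b β x f = quadratureError w a b β x g := by
  unfold quadratureError
  congr 1
  · refine intervalIntegral.integral_congr fun s hs => ?_
    rw [uIcc_of_le hab] at hs
    simp only [hfg hs]
  · exact Finset.sum_congr rfl fun r _ => by rw [hfg (hx r)]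

theorem quadratureError_add {f g : ℝ → ℝ}
    (hf : IntervalIntegrable (fun s => w s * f s) volume a b)
    (hg : IntervalIntegrable (fun s => w s * g s) volume a b) :
    quadratureError w a b β x (fun s => f s + g s) =
      quadratureError w a b β x f + quadratureError w a b β x g := by
  simp only [quadratureError, mul_add, Finset.sum_add_distrib]
  rw [intervalIntegral.integral_add hf hg]
  ring

theorem measurable_uncurry_stepG (K : ℕ) : Measurable fun q : ℝ × ℝ => stepG q.2 K q.1 := by
  unfold stepG
  exact Measurable.ite (measurableSet_le measurable_snd measurable_fst) (by fun_prop)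
    measurable_const

theorem norm_stepG_le (K : ℕ) {ξ s : ℝ} (hξ : ξ ∈ Icc a b) (hs : s ∈ Icc a b) :
    ‖stepG ξ K s‖ ≤ (b - a) ^ K := by
  have hab : 0 ≤ b - a := sub_nonneg.2 (hξ.1.trans hξ.2)
  unfold stepG
  split_ifs with h
  · rw [norm_pow, norm_of_nonneg (sub_nonneg.2 h)]
    exact pow_le_pow_left₀ (sub_nonneg.2 h) (by linarith [hξ.1, hs.2]) K
  · simpa using pow_nonneg hab K

theorem intervalIntegrable_mul_stepG {φ : ℝ → ℝ} (hab : a ≤ b) (hφ : IntervalIntegrable φ volume a b)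
    (K : ℕ) {s : ℝ} (hs : s ∈ Icc a b) :
    IntervalIntegrable (fun ξ => φ ξ * stepG ξ K s) volume a b := by
  rw [intervalIntegrable_iff_integrableOn_Ioc_of_le hab] at *
  refine Integrable.mul_bdd (c := (b - a) ^ K) hφ ?_ ?_
  · exact ((measurable_uncurry_stepG K).comp measurable_prodMk_left).aestronglyMeasurable
  · filter_upwards [ae_restrict_mem measurableSet_Ioc] with ξ hξ
    exact norm_stepG_le K (Ioc_subset_Icc_self hξ) hs

theorem integrable_prod_mul_stepG {φ : ℝ → ℝ} (hab : a ≤ b)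
    (hw : IntervalIntegrable w volume a b) (hφ : IntervalIntegrable φ volume a b) (K : ℕ) :
    Integrable (Function.uncurry fun s ξ => w s * (φ ξ * stepG ξ K s))
      ((volume.restrict (Ioc a b)).prod (volume.restrict (Ioc a b))) := by
  rw [intervalIntegrable_iff_integrableOn_Ioc_of_le hab] at *
  have h := (Integrable.mul_prod hw hφ).mul_bdd (c := (b - a) ^ K)
    (measurable_uncurry_stepG K).aestronglyMeasurable ?_
  · exact h.congr (.of_forall fun q => mul_assoc _ _ _)
  · rw [Measure.prod_restrict]
    filter_upwards [ae_restrict_mem (measurableSet_Ioc.prod measurableSet_Ioc)] with q hq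
    exact norm_stepG_le K (Ioc_subset_Icc_self hq.2) (Ioc_subset_Icc_self hq.1)

theorem intervalIntegrable_quadratureError_stepG (hab : a ≤ b) (hx : ∀ r, x r ∈ Icc a b)
    (hw : IntervalIntegrable w volume a b) (K : ℕ) :
    IntervalIntegrable (fun ξ => quadratureError w a b β x (stepG ξ K)) volume a b := by
  refine IntervalIntegrable.sub ?_ ?_
  · have h := (integrable_prod_mul_stepG hab hw
      (intervalIntegrable_const (c := (1 : ℝ))) K).integral_prod_right
    rw [intervalIntegrable_iff_integrableOn_Ioc_of_le hab]
    simpa [IntegrableOn, intervalIntegral.integral_of_le hab] using h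
  · have hsum : ∀ r ∈ Finset.univ,
        IntervalIntegrable (fun ξ => β r * stepG ξ K (x r)) volume a b := fun r _ => by
      simpa using (intervalIntegrable_mul_stepG hab (intervalIntegrable_const (c := (1 : ℝ))) K
        (hx r)).const_mul (β r)
    simpa only [Finset.sum_fn] using IntervalIntegrable.sum _ hsum

theorem intervalIntegrable_mul_integral_stepG {φ : ℝ → ℝ} (hab : a ≤ b)
    (hw : IntervalIntegrable w volume a b) (hφ : IntervalIntegrable φ volume a b) (K : ℕ) :
    IntervalIntegrable (fun s => w s * ∫ ξ in a..b, φ ξ * stepG ξ K s) volume a b := by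
  have h := (integrable_prod_mul_stepG hab hw hφ K).integral_prod_left
  rw [intervalIntegrable_iff_integrableOn_Ioc_of_le hab]
  simpa [IntegrableOn, intervalIntegral.integral_of_le hab, integral_const_mul] using h

theorem quadratureError_integral_stepG {φ : ℝ → ℝ} (hab : a ≤ b) (hx : ∀ r, x r ∈ Icc a b)
    (hw : IntervalIntegrable w volume a b) (hφ : IntervalIntegrable φ volume a b) (K : ℕ) :
    quadratureError w a b β x (fun s => ∫ ξ in a..b, φ ξ * stepG ξ K s) =
      ∫ ξ in a..b, φ ξ * quadratureError w a b β x (stepG ξ K) := by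
  have hprod := integrable_prod_mul_stepG hab hw hφ K
  have hsum : ∀ r ∈ Finset.univ,
      IntervalIntegrable (fun ξ => β r * (φ ξ * stepG ξ K (x r))) volume a b :=
    fun r _ => (intervalIntegrable_mul_stepG hab hφ K (hx r)).const_mul _
  have hint : IntervalIntegrable (fun ξ => ∫ s in a..b, w s * (φ ξ * stepG ξ K s))
      volume a b := by
    rw [intervalIntegrable_iff_integrableOn_Ioc_of_le hab]
    simpa [IntegrableOn, intervalIntegral.integral_of_le hab] using hprod.integral_prod_right
  calc quadratureError w a b β x (fun s => ∫ ξ in a..b, φ ξ * stepG ξ K s)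
      = (∫ s in a..b, ∫ ξ in a..b, w s * (φ ξ * stepG ξ K s)) -
          ∑ r, ∫ ξ in a..b, β r * (φ ξ * stepG ξ K (x r)) := by
        simp only [quadratureError, intervalIntegral.integral_const_mul]
    _ = (∫ ξ in a..b, ∫ s in a..b, w s * (φ ξ * stepG ξ K s)) -
          ∫ ξ in a..b, ∑ r, β r * (φ ξ * stepG ξ K (x r)) := by
        rw [intervalIntegral.integral_finsetSum hsum]
        simp only [intervalIntegral.integral_of_le hab]
        rw [integral_integral_swap hprod]
    _ = _ := by
        rw [← intervalIntegral.integral_sub hint (by simpa only [Finset.sum_fn] using IntervalIntegrable.sum _ hsum)]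
        refine intervalIntegral.integral_congr fun ξ _ => ?_
        simp only [quadratureError, mul_sub, Finset.mul_sum,
          ← intervalIntegral.integral_const_mul, mul_left_comm]

theorem integral_mul_stepG {s : ℝ} (hs : s ∈ Icc a b) {φ : ℝ → ℝ}
    (hφ : IntervalIntegrable φ volume a b) (K : ℕ) :
    ∫ ξ in a..b, φ ξ * stepG ξ K s = ∫ ξ in a..s, φ ξ * (s - ξ) ^ K := by
  have hint := intervalIntegrable_mul_stepG (hs.1.trans hs.2) hφ K hs
  have h₁ : uIcc a s ⊆ uIcc a b := by
    rw [uIcc_of_le hs.1, uIcc_of_le (hs.1.trans hs.2)]; exact Icc_subset_Icc_right hs.2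
  have h₂ : uIcc s b ⊆ uIcc a b := by
    rw [uIcc_of_le hs.2, uIcc_of_le (hs.1.trans hs.2)]; exact Icc_subset_Icc_left hs.1
  rw [← intervalIntegral.integral_add_adjacent_intervals (hint.mono_set h₁) (hint.mono_set h₂)]
  have hzero : ∫ ξ in s..b, φ ξ * stepG ξ K s = 0 := by
    rw [intervalIntegral.integral_of_le hs.2]
    refine setIntegral_eq_zero_of_forall_eq_zero fun ξ hξ => ?_
    simp [stepG, not_le.2 hξ.1]
  rw [hzero, add_zero]
  refine intervalIntegral.integral_congr fun ξ hξ => ?_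
  rw [uIcc_of_le hs.1] at hξ
  simp [stepG, hξ.2]

theorem integral_stepG_eq_stepG_succ {s : ℝ} (hs : s ∈ Icc a b) (K : ℕ) :
    ∫ ξ in a..b, ((K : ℝ) + 1) * stepG ξ K s = stepG a (K + 1) s := by
  rw [integral_mul_stepG hs intervalIntegrable_const K, intervalIntegral.integral_const_mul,
    intervalIntegral.integral_comp_sub_left (fun y => y ^ K) s]
  have hK : (K : ℝ) + 1 ≠ 0 := by positivity
  simp [stepG, hs.1]
  field_simp

theorem exists_polynomial_add_integral_stepG (hab : a < b) {f : ℝ → ℝ} {K : ℕ}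
    (hf : ContDiffOn ℝ (K + 1) f (Icc a b)) :
    ∃ p : Polynomial ℝ, p.natDegree ≤ K ∧ ∀ s ∈ Icc a b, f s = p.eval s +
      ∫ ξ in a..b, iteratedDerivWithin (K + 1) f (Icc a b) ξ / (K.factorial : ℝ) * stepG ξ K s := by
  have hcont : ContinuousOn (iteratedDerivWithin (K + 1) f (Icc a b)) (Icc a b) :=
    hf.continuousOn_iteratedDerivWithin (by norm_cast) (uniqueDiffOn_Icc hab)
  refine ⟨∑ k ∈ Finset.range (K + 1), Polynomial.C ((k.factorial : ℝ)⁻¹ *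
    iteratedDerivWithin k f (Icc a b) a) * (Polynomial.X - Polynomial.C a) ^ k, ?_, ?_⟩
  · refine Polynomial.natDegree_sum_le_of_forall_le _ _ fun k hk => ?_
    refine (Polynomial.natDegree_C_mul_le _ _).trans ?_
    rw [Polynomial.natDegree_pow, Polynomial.natDegree_X_sub_C]
    have := Finset.mem_range.1 hk
    lia
  · intro s hs
    rw [integral_mul_stepG hs ((hcont.div_const _).intervalIntegrable_of_Icc hab.le) K]
    rcases hs.1.eq_or_lt with rfl | has
    · simp [Polynomial.eval_finsetSum, Finset.sum_range_succ']
    have hsub : uIcc a s ⊆ Icc a b := by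
      rw [uIcc_of_le hs.1]; exact Icc_subset_Icc_right hs.2
    have htaylor := taylor_integral_remainder (n := K) (x₀ := a) (x := s)
      ((hf.mono hsub).of_le (by norm_cast))
    rw [uIcc_of_le hs.1] at htaylor
    have hgerm : ∀ k, ∀ ξ ∈ Ico a s,
        iteratedDerivWithin k f (Icc a s) ξ = iteratedDerivWithin k f (Icc a b) ξ := by
      intro k ξ hξ
      have hset : (Icc a s : Set ℝ) =ᶠ[nhds ξ] Icc a b := by
        filter_upwards [Iio_mem_nhds hξ.2] with y hy
        exact propext ⟨fun h => ⟨h.1, h.2.trans hs.2⟩, fun h => ⟨h.1, le_of_lt hy⟩⟩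
      simp only [iteratedDerivWithin, iteratedFDerivWithin_congr_set hset]
    rw [sub_eq_iff_eq_add'] at htaylor
    rw [htaylor, taylor_within_apply]
    congr 1
    · simp only [Polynomial.eval_finsetSum]
      refine Finset.sum_congr rfl fun k _ => ?_
      rw [hgerm k a ⟨le_rfl, has⟩]
      simp
      ring
    · refine intervalIntegral.integral_congr_uIoo fun ξ hξ => ?_
      rw [uIoo_of_le hs.1] at hξ
      simp only [smul_eq_mul]
      rw [hgerm _ ξ ⟨hξ.1.le, hξ.2⟩]
      ring

theorem exists_eq_const_mul_integral_Ioo_of_nonneg (hab : a < b) {φ κ : ℝ → ℝ}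
    (hφ : ContinuousOn φ (Icc a b)) (hκ : IntervalIntegrable κ volume a b)
    (h0 : ∀ ξ ∈ Icc a b, 0 ≤ κ ξ) :
    ∃ ζ ∈ Ioo a b, ∫ ξ in a..b, φ ξ * κ ξ = φ ζ * ∫ ξ in a..b, κ ξ := by
  have hφκ : IntervalIntegrable (fun ξ => φ ξ * κ ξ) volume a b :=
    hκ.continuousOn_mul (by rwa [uIcc_of_le hab.le])
  simp only [intervalIntegral.integral_of_le hab.le, integral_Ioc_eq_integral_Ioo]
  rw [intervalIntegrable_iff_integrableOn_Ioo_of_le hab.le] at hκ hφκ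
  exact exists_eq_const_mul_setIntegral_of_nonneg (isConnected_Ioo hab) measurableSet_Ioo
    (hφ.mono Ioo_subset_Icc_self) hκ hφκ fun ξ hξ => h0 ξ (Ioo_subset_Icc_self hξ)

theorem exists_eq_const_mul_integral_Ioo (hab : a < b) {φ κ : ℝ → ℝ}
    (hφ : ContinuousOn φ (Icc a b)) (hκ : IntervalIntegrable κ volume a b)
    (h0 : (∀ ξ ∈ Icc a b, 0 ≤ κ ξ) ∨ ∀ ξ ∈ Icc a b, κ ξ ≤ 0) :
    ∃ ζ ∈ Ioo a b, ∫ ξ in a..b, φ ξ * κ ξ = φ ζ * ∫ ξ in a..b, κ ξ := by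
  rcases h0 with h0 | h0
  · exact exists_eq_const_mul_integral_Ioo_of_nonneg hab hφ hκ h0
  · simpa using exists_eq_const_mul_integral_Ioo_of_nonneg hab hφ hκ.neg
      fun ξ hξ => neg_nonneg.2 (h0 ξ hξ)

theorem quadratureError_mean_value (hab : a < b) (hx : ∀ r, x r ∈ Icc a b)
    (hw : IntervalIntegrable w volume a b) {K : ℕ} {f : ℝ → ℝ}
    (hf : ContDiffOn ℝ (K + 1) f (Icc a b))
    (hexact : ∀ p : Polynomial ℝ, p.natDegree ≤ K →
      quadratureError w a b β x (fun s => p.eval s) = 0)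
    (hsign : (∀ ξ ∈ Icc a b, 0 ≤ quadratureError w a b β x (stepG ξ K)) ∨
      ∀ ξ ∈ Icc a b, quadratureError w a b β x (stepG ξ K) ≤ 0) :
    ∃ ζ ∈ Ioo a b, quadratureError w a b β x f =
      iteratedDerivWithin (K + 1) f (Icc a b) ζ / ((K + 1).factorial : ℝ) *
        quadratureError w a b β x (stepG a (K + 1)) := by
  have hφ : ContinuousOn (fun ξ => iteratedDerivWithin (K + 1) f (Icc a b) ξ /
      (K.factorial : ℝ)) (Icc a b) :=
    (hf.continuousOn_iteratedDerivWithin (by norm_cast) (uniqueDiffOn_Icc hab)).div_const _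
  have hφ' := hφ.intervalIntegrable_of_Icc (μ := volume) hab.le
  obtain ⟨p, hp, hfp⟩ := exists_polynomial_add_integral_stepG hab hf
  obtain ⟨ζ, hζ, hmean⟩ := exists_eq_const_mul_integral_Ioo hab hφ
    (intervalIntegrable_quadratureError_stepG hab.le hx hw K) hsign
  refine ⟨ζ, hζ, ?_⟩
  have hstep : quadratureError w a b β x (stepG a (K + 1)) =
      ((K : ℝ) + 1) * ∫ ξ in a..b, quadratureError w a b β x (stepG ξ K) := by
    rw [quadratureError_congr hab.le hx fun s hs => (integral_stepG_eq_stepG_succ hs K).symm,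
      quadratureError_integral_stepG hab.le hx hw intervalIntegrable_const K,
      intervalIntegral.integral_const_mul]
  rw [quadratureError_congr hab.le hx hfp,
    quadratureError_add (hw.mul_continuousOn p.continuous.continuousOn)
      (intervalIntegrable_mul_integral_stepG hab.le hw hφ' K),
    hexact p hp, zero_add, quadratureError_integral_stepG hab.le hx hw hφ' K, hmean, hstep,
    Nat.factorial_succ]
  push_cast
  field_simp

end PeanoKernel

theorem peano_kernel_mean_value (α lam t0 h : ℝ) (hα : 0 < α) (hh : 0 < h) (ν : ℕ)
    (c : Fin ν → ℝ) (hc : ∀ r, c r ∈ Set.Icc (0 : ℝ) 1) (b : Fin ν → ℕ → ℝ)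
    (n j K : ℕ) (hjn : j < n) (f : ℝ → ℝ)
    (hf : ContDiffOn ℝ (K + 1) f
      (Set.Icc (t0 + (j : ℝ) * h) (t0 + ((j : ℝ) + 1) * h)))
    (hexact : ∀ p : Polynomial ℝ, p.natDegree ≤ K →
      quadT α lam t0 h c b n j (fun x => p.eval x) = 0)
    (hsign :
      (∀ ξ ∈ Set.Icc (t0 + (j : ℝ) * h) (t0 + ((j : ℝ) + 1) * h),
          0 ≤ quadT α lam t0 h c b n j (stepG ξ K)) ∨
      (∀ ξ ∈ Set.Icc (t0 + (j : ℝ) * h) (t0 + ((j : ℝ) + 1) * h),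
          quadT α lam t0 h c b n j (stepG ξ K) ≤ 0)) :
    ∃ ζ ∈ Set.Ioo (t0 + (j : ℝ) * h) (t0 + ((j : ℝ) + 1) * h),
      quadT α lam t0 h c b n j f
        = (iteratedDerivWithin (K + 1) f
              (Set.Icc (t0 + (j : ℝ) * h) (t0 + ((j : ℝ) + 1) * h)) ζ
            / ((K + 1).factorial : ℝ))
            * quadT α lam t0 h c b n j (stepG (t0 + (j : ℝ) * h) (K + 1)) := by
  have hab : t0 + (j : ℝ) * h < t0 + ((j : ℝ) + 1) * h := by linarith
  have hn : (j : ℝ) + 1 ≤ n := by exact_mod_cast hjn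
  have hn' : ((j : ℝ) + 1) * h ≤ n * h := by gcongr
  have hx : ∀ r, t0 + (j : ℝ) * h + c r * h ∈
      Icc (t0 + (j : ℝ) * h) (t0 + ((j : ℝ) + 1) * h) := by
    intro r
    have h0 := mul_nonneg (hc r).1 hh.le
    have h1 := mul_le_mul_of_nonneg_right (hc r).2 hh.le
    constructor <;> linarith
  have hw : IntervalIntegrable (fun s => mlE α α (t0 + (n : ℝ) * h - s) lam) volume
      (t0 + (j : ℝ) * h) (t0 + ((j : ℝ) + 1) * h) := by
    have := (intervalIntegrable_mlE hα lam (a := t0 + n * h - (t0 + j * h))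
      (b := t0 + n * h - (t0 + (j + 1) * h)) (by linarith) (by linarith)).comp_sub_left
        (t0 + n * h)
    simpa only [sub_sub_cancel] using this
  exact quadratureError_mean_value (β := fun r => b r (n - j)) hab hx hw hf hexact hsign
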